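/- arXiv:1410.5654 — 2 statements merged into one kernel-verified Lean document; each statement's English description precedes it below -/
import Mathlib

section
/- Let K be an algebraically closed field of characteristic 0. There exist three homogeneous ideals J_1, J_2, J_3 of K[x,y] such that every homogeneous ideal I of K[x,y] with Hilbert function t_I(0)=1, t_I(1)=2, t_I(2)=3, t_I(3)=1, and t_I(k)=0 for k ≥ 4 satisfies φ(I) ∈ {J_1, J_2, J_3} for some linear change of variables φ. -/
open MvPolynomial

noncomputable section

/-- The polynomial ring `K[x,y]`. -/
abbrev Pxy (K : Type*) [Field K] := MvPolynomial (Fin 2) K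

/-- An ideal of `K[x,y]` is homogeneous if it contains all homogeneous
components of each of its elements. -/
def IsHomog {K : Type*} [Field K] (I : Ideal (Pxy K)) : Prop :=
  ∀ f ∈ I, ∀ k : ℕ, homogeneousComponent k f ∈ I

/-- The Hilbert function of an ideal:
`t_I(k) = dim_K (K[x,y]_k / (I ∩ K[x,y]_k))`. -/
def hilb (K : Type*) [Field K] (I : Ideal (Pxy K)) (k : ℕ) : ℕ :=
  Module.finrank K
    (homogeneousSubmodule (Fin 2) K k ⧸
      Submodule.comap (homogeneousSubmodule (Fin 2) K k).subtype (I.restrictScalars K))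

/-- A linear change of variables: a `K`-algebra automorphism sending the
variables to homogeneous polynomials of degree 1. -/
def IsLinChange {K : Type*} [Field K] (φ : Pxy K ≃ₐ[K] Pxy K) : Prop :=
  ∀ i : Fin 2, (φ (X i)).IsHomogeneous 1

/-- `t` is of homogeneous finite type: there are finitely many homogeneous ideals
`J₁, …, Jₘ` such that every homogeneous ideal `I` with Hilbert function `t` is
mapped onto some `Jᵢ` by a linear change of variables. -/
def HomogFiniteType (K : Type*) [Field K] (t : ℕ → ℕ) : Prop :=
  ∃ S : Set (Ideal (Pxy K)), S.Finite ∧ (∀ J ∈ S, IsHomog J) ∧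
    ∀ I : Ideal (Pxy K), IsHomog I → (∀ k, hilb K I k = t k) →
      ∃ φ : Pxy K ≃ₐ[K] Pxy K, IsLinChange φ ∧ Ideal.map φ I ∈ S

/-- The symmetric trilinear form on linear forms, `(ℓ₁, ℓ₂, ℓ₃) ↦ L (ℓ₁ ℓ₂ ℓ₃)`, of the functional
`L` on binary cubics with values `A`, `B`, `C`, `D` at `x³`, `x²y`, `xy²`, `y³`. -/
def polar {K : Type*} [Field K] (A B C D a₁ a₂ b₁ b₂ c₁ c₂ : K) : K :=
  a₁ * b₁ * c₁ * A + (a₁ * b₁ * c₂ + a₁ * b₂ * c₁ + a₂ * b₁ * c₁) * B +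
    (a₁ * b₂ * c₂ + a₂ * b₁ * c₂ + a₂ * b₂ * c₁) * C + a₂ * b₂ * c₂ * D

/-- In suitable coordinates, the functional with values `A`, `B`, `C`, `D` at `x³`, `x²y`, `xy²`,
`y³` is a nonzero multiple of one with values `(1, 0, 0, 1)`, `(0, 1, 0, 0)` or `(1, 0, 0, 0)`. -/
def HasNormalForm {K : Type*} [Field K] (A B C D : K) : Prop :=
  ∃ a₁ a₂ b₁ b₂ t : K, a₁ * b₂ - a₂ * b₁ ≠ 0 ∧ t ≠ 0 ∧
    ((polar A B C D a₁ a₂ a₁ a₂ a₁ a₂ = t ∧ polar A B C D a₁ a₂ a₁ a₂ b₁ b₂ = 0 ∧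
        polar A B C D a₁ a₂ b₁ b₂ b₁ b₂ = 0 ∧ polar A B C D b₁ b₂ b₁ b₂ b₁ b₂ = t) ∨
      (polar A B C D a₁ a₂ a₁ a₂ a₁ a₂ = 0 ∧ polar A B C D a₁ a₂ a₁ a₂ b₁ b₂ = t ∧
        polar A B C D a₁ a₂ b₁ b₂ b₁ b₂ = 0 ∧ polar A B C D b₁ b₂ b₁ b₂ b₁ b₂ = 0) ∨
      (polar A B C D a₁ a₂ a₁ a₂ a₁ a₂ = t ∧ polar A B C D a₁ a₂ a₁ a₂ b₁ b₂ = 0 ∧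
        polar A B C D a₁ a₂ b₁ b₂ b₁ b₂ = 0 ∧ polar A B C D b₁ b₂ b₁ b₂ b₁ b₂ = 0))

section NormalForm

variable {K : Type*} [Field K] {A B C D a₁ a₂ b₁ b₂ : K}

theorem eq_zero_of_polar_eq_zero (h : a₁ * b₂ - a₂ * b₁ ≠ 0)
    (h₀ : polar A B C D a₁ a₂ a₁ a₂ a₁ a₂ = 0) (h₁ : polar A B C D a₁ a₂ a₁ a₂ b₁ b₂ = 0)
    (h₂ : polar A B C D a₁ a₂ b₁ b₂ b₁ b₂ = 0) (h₃ : polar A B C D b₁ b₂ b₁ b₂ b₁ b₂ = 0) :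
    A = 0 ∧ B = 0 ∧ C = 0 ∧ D = 0 := by
  unfold polar at *
  have h' := pow_ne_zero 3 h
  refine ⟨?_, ?_, ?_, ?_⟩ <;> refine (mul_eq_zero.mp ?_).resolve_left h'
  · linear_combination b₂ ^ 3 * h₀ - 3 * b₂ ^ 2 * a₂ * h₁ + 3 * b₂ * a₂ ^ 2 * h₂ - a₂ ^ 3 * h₃
  · linear_combination -b₂ ^ 2 * b₁ * h₀ + (b₂ ^ 2 * a₁ + 2 * b₂ * a₂ * b₁) * h₁ -
      (a₂ ^ 2 * b₁ + 2 * b₂ * a₂ * a₁) * h₂ + a₂ ^ 2 * a₁ * h₃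
  · linear_combination b₁ ^ 2 * b₂ * h₀ - (b₁ ^ 2 * a₂ + 2 * b₁ * a₁ * b₂) * h₁ +
      (a₁ ^ 2 * b₂ + 2 * b₁ * a₁ * a₂) * h₂ - a₁ ^ 2 * a₂ * h₃
  · linear_combination -b₁ ^ 3 * h₀ + 3 * b₁ ^ 2 * a₁ * h₁ - 3 * b₁ * a₁ ^ 2 * h₂ + a₁ ^ 3 * h₃

theorem hasNormalForm_of_distinct [IsAlgClosed K] (hne : ¬(A = 0 ∧ B = 0 ∧ C = 0 ∧ D = 0))
    (h : a₁ * b₂ - a₂ * b₁ ≠ 0) (h₁ : polar A B C D a₁ a₂ a₁ a₂ b₁ b₂ = 0)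
    (h₂ : polar A B C D a₁ a₂ b₁ b₂ b₁ b₂ = 0) : HasNormalForm A B C D := by
  by_cases h₃ : polar A B C D b₁ b₂ b₁ b₂ b₁ b₂ = 0
  · exact ⟨a₁, a₂, b₁, b₂, _, h, fun h₀ => hne (eq_zero_of_polar_eq_zero h h₀ h₁ h₂ h₃),
      .inr (.inr ⟨rfl, h₁, h₂, h₃⟩)⟩
  by_cases h₀ : polar A B C D a₁ a₂ a₁ a₂ a₁ a₂ = 0
  · refine ⟨b₁, b₂, a₁, a₂, _, fun h' => h (by linear_combination -h'), h₃,
      .inr (.inr ⟨rfl, ?_, ?_, h₀⟩)⟩ <;> unfold polar at *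
    · linear_combination h₂
    · linear_combination h₁
  obtain ⟨z, hz⟩ := IsAlgClosed.exists_pow_nat_eq
    (polar A B C D a₁ a₂ a₁ a₂ a₁ a₂ / polar A B C D b₁ b₂ b₁ b₂ b₁ b₂) (n := 3) (by norm_num)
  have hz0 : z ≠ 0 := by
    rintro rfl
    exact div_ne_zero h₀ h₃ (by simpa using hz.symm)
  rw [eq_div_iff h₃] at hz
  refine ⟨a₁, a₂, z * b₁, z * b₂, _, fun h' => mul_ne_zero hz0 h (by linear_combination h'), h₀,
    .inl ⟨rfl, ?_, ?_, ?_⟩⟩ <;> unfold polar at *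
  · linear_combination z * h₁
  · linear_combination z ^ 2 * h₂
  · linear_combination hz

theorem hasNormalForm_of_double [CharZero K] (hne : ¬(A = 0 ∧ B = 0 ∧ C = 0 ∧ D = 0))
    (h : a₁ * b₂ - a₂ * b₁ ≠ 0) (h₂ : polar A B C D a₁ a₂ b₁ b₂ b₁ b₂ = 0)
    (h₃ : polar A B C D b₁ b₂ b₁ b₂ b₁ b₂ = 0) : HasNormalForm A B C D := by
  by_cases h₁ : polar A B C D a₁ a₂ a₁ a₂ b₁ b₂ = 0
  · exact ⟨a₁, a₂, b₁, b₂, _, h, fun h₀ => hne (eq_zero_of_polar_eq_zero h h₀ h₁ h₂ h₃),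
      .inr (.inr ⟨rfl, h₁, h₂, h₃⟩)⟩
  obtain ⟨t, ht⟩ : ∃ t, polar A B C D a₁ a₂ a₁ a₂ a₁ a₂ +
      3 * t * polar A B C D a₁ a₂ a₁ a₂ b₁ b₂ = 0 :=
    ⟨-polar A B C D a₁ a₂ a₁ a₂ a₁ a₂ / (3 * polar A B C D a₁ a₂ a₁ a₂ b₁ b₂), by
      field_simp; ring⟩
  refine ⟨a₁ + t * b₁, a₂ + t * b₂, b₁, b₂, polar A B C D a₁ a₂ a₁ a₂ b₁ b₂,
    fun h' => h (by linear_combination h'), h₁, .inr (.inl ⟨?_, ?_, ?_, h₃⟩)⟩ <;> unfold polar at *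
  · linear_combination ht + 3 * t ^ 2 * h₂ + t ^ 3 * h₃
  · linear_combination 2 * t * h₂ + t ^ 2 * h₃
  · linear_combination h₂ + t * h₃

theorem hasNormalForm_of_minors_eq_zero (hne : ¬(A = 0 ∧ B = 0 ∧ C = 0 ∧ D = 0))
    (hu : B * D - C ^ 2 = 0) (hv : B * C - A * D = 0) (hw : A * C - B ^ 2 = 0) :
    HasNormalForm A B C D := by
  by_cases hA : A = 0
  · subst hA
    have hB : B = 0 := by simpa using hw
    subst hB
    have hC : C = 0 := by simpa using hu
    subst hC
    refine ⟨0, 1, 1, 0, D, by simp, fun h => hne ⟨rfl, rfl, rfl, h⟩, ?_⟩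
    simp [polar]
  · have hC : C = B ^ 2 / A := by field_simp; linear_combination hw
    have hD : D = B * C / A := by field_simp; linear_combination -hv
    refine ⟨1, 0, -B / A, 1, A, by simp, hA, .inr (.inr ⟨?_, ?_, ?_, ?_⟩)⟩ <;>
      rw [hD, hC] <;> unfold polar <;> field_simp <;> ring

theorem exists_quadratic_factorization [CharZero K] [IsAlgClosed K] (u v w : K) :
    ∃ a₁ a₂ b₁ b₂ : K, a₁ * b₁ = u ∧ a₁ * b₂ + a₂ * b₁ = v ∧ a₂ * b₂ = w := by
  by_cases hu : u = 0
  · exact ⟨0, 1, v, w, by simp [hu]⟩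
  obtain ⟨s, hs⟩ := IsAlgClosed.exists_pow_nat_eq (discrim u v w) (n := 2) (by norm_num)
  obtain ⟨t, ht⟩ := exists_quadratic_eq_zero hu ⟨s, by rw [← hs, sq]⟩
  exact ⟨1, -t, u, v + u * t, by ring, by ring, by linear_combination -ht⟩

theorem hasNormalForm [IsAlgClosed K] [CharZero K] (hne : ¬(A = 0 ∧ B = 0 ∧ C = 0 ∧ D = 0)) :
    HasNormalForm A B C D := by
  by_cases hm : B * D - C ^ 2 = 0 ∧ B * C - A * D = 0 ∧ A * C - B ^ 2 = 0
  · exact hasNormalForm_of_minors_eq_zero hne hm.1 hm.2.1 hm.2.2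
  obtain ⟨a₁, a₂, b₁, b₂, hu, hv, hw⟩ :=
    exists_quadratic_factorization (B * D - C ^ 2) (B * C - A * D) (A * C - B ^ 2)
  have key : ∀ c₁ c₂, polar A B C D c₁ c₂ a₁ a₂ b₁ b₂ = 0 := fun c₁ c₂ => by
    unfold polar
    linear_combination (c₁ * A + c₂ * B) * hu + (c₁ * B + c₂ * C) * hv + (c₁ * C + c₂ * D) * hw
  by_cases h : a₁ * b₂ - a₂ * b₁ = 0
  · have ha : ¬(a₁ = 0 ∧ a₂ = 0) := by
      rintro ⟨rfl, rfl⟩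
      exact hm ⟨by rw [← hu]; ring, by rw [← hv]; ring, by rw [← hw]; ring⟩
    have hb : ¬(b₁ = 0 ∧ b₂ = 0) := by
      rintro ⟨rfl, rfl⟩
      exact hm ⟨by rw [← hu]; ring, by rw [← hv]; ring, by rw [← hw]; ring⟩
    have key' : ∀ c₁ c₂, polar A B C D c₁ c₂ b₁ b₂ b₁ b₂ = 0 := fun c₁ c₂ => by
      by_cases h1 : a₁ = 0
      · have h2 : a₂ ≠ 0 := fun h2 => ha ⟨h1, h2⟩
        refine (mul_eq_zero.mp ?_).resolve_left h2
        have := key c₁ c₂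
        unfold polar at *
        linear_combination b₂ * this - ((c₁ * b₁) * A + (c₁ * b₂ + c₂ * b₁) * B + c₂ * b₂ * C) * h
      · refine (mul_eq_zero.mp ?_).resolve_left h1
        have := key c₁ c₂
        unfold polar at *
        linear_combination b₁ * this + ((c₁ * b₁) * B + (c₁ * b₂ + c₂ * b₁) * C + c₂ * b₂ * D) * h
    by_cases h2 : b₂ = 0
    · exact hasNormalForm_of_double (a₁ := 0) (a₂ := 1) (b₁ := b₁) (b₂ := b₂) hne
        (by simpa using fun h1 => hb ⟨h1, h2⟩) (key' _ _) (key' _ _)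
    · exact hasNormalForm_of_double (a₁ := 1) (a₂ := 0) (b₁ := b₁) (b₂ := b₂) hne
        (by simpa using h2) (key' _ _) (key' _ _)
  · refine hasNormalForm_of_distinct hne h (key _ _) ?_
    have := key b₁ b₂
    unfold polar at *
    linear_combination this

end NormalForm

section Ideals

variable {K : Type*} [Field K]

theorem homogeneousSubmodule_eq_span (k : ℕ) :
    homogeneousSubmodule (Fin 2) K k =
      Submodule.span K (Set.range fun i : Fin (k + 1) =>
        (X 0 ^ (i : ℕ) * X 1 ^ (k - i) : Pxy K)) := by
  apply le_antisymm
  · intro p hp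
    rw [p.as_sum]
    refine Submodule.sum_mem _ fun m hm => ?_
    have hdeg : m 0 + m 1 = k := by
      by_contra h
      refine mem_support_iff.mp hm (IsHomogeneous.coeff_eq_zero hp ?_)
      rwa [Finsupp.degree_eq_sum, Fin.sum_univ_two]
    rw [monomial_eq, ← smul_eq_C_mul, Finsupp.prod_fintype _ _ (by simp), Fin.prod_univ_two]
    refine Submodule.smul_mem _ _ (Submodule.subset_span ⟨⟨m 0, by omega⟩, ?_⟩)
    simp only [show k - m 0 = m 1 by omega]
  · rw [Submodule.span_le]
    rintro _ ⟨i, rfl⟩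
    have := (isHomogeneous_X_pow (R := K) (0 : Fin 2) i).mul (isHomogeneous_X_pow 1 (k - i))
    rwa [show (i : ℕ) + (k - i) = k by omega] at this

instance finite_homogeneousSubmodule (k : ℕ) :
    Module.Finite K (homogeneousSubmodule (Fin 2) K k) := by
  rw [homogeneousSubmodule_eq_span]
  exact FiniteDimensional.span_of_finite K (Set.finite_range _)

theorem finrank_homogeneousSubmodule_le (k : ℕ) :
    Module.finrank K (homogeneousSubmodule (Fin 2) K k) ≤ k + 1 := by
  rw [homogeneousSubmodule_eq_span]
  exact (finrank_range_le_card _).trans (by simp)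

theorem eq_zero_of_hilb_eq_succ {I : Ideal (Pxy K)} {k : ℕ} (h : hilb K I k = k + 1)
    {f : Pxy K} (hf : f.IsHomogeneous k) (hI : f ∈ I) : f = 0 := by
  set W := Submodule.comap (homogeneousSubmodule (Fin 2) K k).subtype (I.restrictScalars K) with hW
  have h1 : Module.finrank K (_ ⧸ W) = k + 1 := h
  have h2 := W.finrank_quotient_add_finrank
  have h3 := finrank_homogeneousSubmodule_le (K := K) k
  have h4 : W = ⊥ := Submodule.finrank_eq_zero.mp (by omega)
  have h5 : (⟨f, hf⟩ : homogeneousSubmodule (Fin 2) K k) ∈ W := hI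
  rw [h4, Submodule.mem_bot] at h5
  exact congrArg Subtype.val h5

theorem mem_of_hilb_eq_zero {I : Ideal (Pxy K)} {k : ℕ} (h : hilb K I k = 0)
    {f : Pxy K} (hf : f.IsHomogeneous k) : f ∈ I := by
  have h1 := Module.finrank_zero_iff.mp h
  have h2 := Submodule.Quotient.subsingleton_iff.mp h1
  have h3 : (⟨f, hf⟩ : homogeneousSubmodule (Fin 2) K k) ∈
      Submodule.comap (homogeneousSubmodule (Fin 2) K k).subtype (I.restrictScalars K) :=
    h2 ▸ Submodule.mem_top
  exact h3

theorem IsHomog.mem_iff {I : Ideal (Pxy K)} (hI : IsHomog I) {f : Pxy K} :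
    f ∈ I ↔ ∀ k, homogeneousComponent k f ∈ I := by
  refine ⟨hI f, fun h => ?_⟩
  rw [← sum_homogeneousComponent f]
  exact Ideal.sum_mem _ fun k _ => h k

theorem exists_functional {I : Ideal (Pxy K)} (hI : IsHomog I) (h0 : hilb K I 0 = 1)
    (h1 : hilb K I 1 = 2) (h2 : hilb K I 2 = 3) (h3 : hilb K I 3 = 1)
    (h4 : ∀ k, 4 ≤ k → hilb K I k = 0) :
    ∃ L : Pxy K →ₗ[K] K, (∃ p : Pxy K, p.IsHomogeneous 3 ∧ L p ≠ 0) ∧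
      ∀ f, f ∈ I ↔ (∀ k < 3, homogeneousComponent k f = 0) ∧ L (homogeneousComponent 3 f) = 0 := by
  set W := Submodule.comap (homogeneousSubmodule (Fin 2) K 3).subtype (I.restrictScalars K)
  have hW : Module.finrank K (_ ⧸ W) = 1 := h3
  let e : (_ ⧸ W) ≃ₗ[K] K := LinearEquiv.ofFinrankEq _ _ (by rw [hW, Module.finrank_self])
  let L : Pxy K →ₗ[K] K := e.toLinearMap ∘ₗ W.mkQ ∘ₗ
    (homogeneousComponent 3).codRestrict (homogeneousSubmodule (Fin 2) K 3)
      fun f => homogeneousComponent_mem 3 f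
  have hL : ∀ f : Pxy K, f.IsHomogeneous 3 → (L f = 0 ↔ f ∈ I) := fun f hf => by
    have : L f = e (W.mkQ ⟨f, hf⟩) := by
      simp only [L, LinearMap.comp_apply, LinearEquiv.coe_coe]
      congr 2
      exact Subtype.ext (homogeneousComponent_eq_self hf)
    rw [this, EmbeddingLike.map_eq_zero_iff, Submodule.mkQ_apply, Submodule.Quotient.mk_eq_zero]
    rfl
  refine ⟨L, ?_, fun f => ?_⟩
  · by_contra! hp
    have : W = ⊤ := eq_top_iff.mpr fun p _ => (hL p p.2).mp (hp p p.2)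
    rw [← Submodule.Quotient.subsingleton_iff, ← Module.finrank_zero_iff (R := K)] at this
    omega
  · rw [hI.mem_iff, hL _ (homogeneousComponent_isHomogeneous 3 f)]
    refine ⟨fun h => ⟨fun k hk => ?_, h 3⟩, fun h k => ?_⟩
    · refine eq_zero_of_hilb_eq_succ ?_ (homogeneousComponent_isHomogeneous k f) (h k)
      interval_cases k <;> assumption
    · rcases lt_trichotomy k 3 with hk | rfl | hk
      · rw [h.1 k hk]
        exact I.zero_mem
      · exact h.2
      · exact mem_of_hilb_eq_zero (h4 k hk) (homogeneousComponent_isHomogeneous k f)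

theorem homogeneousComponent_X_mul (k : ℕ) (i : Fin 2) (f : Pxy K) :
    homogeneousComponent (k + 1) (X i * f) = X i * homogeneousComponent k f := by
  ext m
  rw [coeff_homogeneousComponent, coeff_X_mul', coeff_X_mul', coeff_homogeneousComponent]
  by_cases hm : i ∈ m.support
  · have h1 : 1 ≤ m i := Nat.one_le_iff_ne_zero.mpr (Finsupp.mem_support_iff.mp hm)
    have h2 := congrArg Finsupp.degree (tsub_add_cancel_of_le (Finsupp.single_le_iff.mpr h1))
    rw [map_add, Finsupp.degree_single] at h2
    simp only [hm, if_true, ← h2, add_left_inj]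
  · simp [hm]

theorem homogeneousComponent_zero_X_mul (i : Fin 2) (f : Pxy K) :
    homogeneousComponent 0 (X i * f) = 0 := by
  simp [homogeneousComponent_zero, coeff_X_mul']

/-- The polynomials of order at least `3` whose cubic part is annihilated by `L`. -/
def cubicIdeal (L : Pxy K →ₗ[K] K) : Ideal (Pxy K) where
  carrier := {f | (∀ k < 3, homogeneousComponent k f = 0) ∧ L (homogeneousComponent 3 f) = 0}
  zero_mem' := by simp
  add_mem' {f g} hf hg := by
    refine ⟨fun k hk => ?_, ?_⟩
    · rw [map_add, hf.1 k hk, hg.1 k hk, add_zero]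
    · rw [map_add, map_add, hf.2, hg.2, add_zero]
  smul_mem' g f hf := by
    rw [smul_eq_mul]
    induction g using MvPolynomial.induction_on with
    | C a =>
      refine ⟨fun k hk => ?_, ?_⟩
      · rw [homogeneousComponent_C_mul, hf.1 k hk, mul_zero]
      · rw [homogeneousComponent_C_mul, ← smul_eq_C_mul, map_smul, hf.2, smul_zero]
    | add p q hp hq =>
      rw [add_mul]
      refine ⟨fun k hk => ?_, ?_⟩
      · rw [map_add, hp.1 k hk, hq.1 k hk, add_zero]
      · rw [map_add, map_add, hp.2, hq.2, add_zero]
    | mul_X p i hp =>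
      rw [mul_comm p, mul_assoc]
      refine ⟨fun k hk => ?_, ?_⟩
      · cases k with
        | zero => exact homogeneousComponent_zero_X_mul i _
        | succ k => rw [homogeneousComponent_X_mul, hp.1 k (by omega), mul_zero]
      · rw [homogeneousComponent_X_mul, hp.1 2 (by omega), mul_zero, map_zero]

theorem mem_cubicIdeal {L : Pxy K →ₗ[K] K} {f : Pxy K} : f ∈ cubicIdeal L ↔
    (∀ k < 3, homogeneousComponent k f = 0) ∧ L (homogeneousComponent 3 f) = 0 :=
  Iff.rfl

theorem isHomog_cubicIdeal (L : Pxy K →ₗ[K] K) : IsHomog (cubicIdeal L) := by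
  intro f hf n
  have key : ∀ k, homogeneousComponent k (homogeneousComponent n f) =
      if k = n then homogeneousComponent n f else 0 := fun k =>
    homogeneousComponent_of_mem (homogeneousComponent_mem n f)
  refine ⟨fun k hk => ?_, ?_⟩
  · rw [key]
    split_ifs with h
    · exact h ▸ hf.1 k hk
    · rfl
  · rw [key]
    split_ifs with h
    · exact h ▸ hf.2
    · exact map_zero L

theorem IsLinChange.homogeneousComponent_apply {φ : Pxy K ≃ₐ[K] Pxy K} (hφ : IsLinChange φ)
    (k : ℕ) (f : Pxy K) : homogeneousComponent k (φ f) = φ (homogeneousComponent k f) := by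
  have hom : ∀ n (p : Pxy K), p.IsHomogeneous n → (φ p).IsHomogeneous n := fun n p hp => by
    have := hp.aeval (fun i => φ (X i)) hφ
    rw [one_mul] at this
    convert this using 1
    exact DFunLike.congr_fun (aeval_unique (φ : Pxy K →ₐ[K] Pxy K)) p
  conv_lhs => rw [← sum_homogeneousComponent f, map_sum, map_sum]
  have : ∀ n, homogeneousComponent k (φ (homogeneousComponent n f)) =
      if k = n then φ (homogeneousComponent n f) else 0 := fun n =>
    homogeneousComponent_of_mem (hom n _ (homogeneousComponent_isHomogeneous n f))
  simp only [this]
  rw [Finset.sum_ite_eq]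
  split_ifs with h
  · rfl
  · rw [homogeneousComponent_eq_zero _ _ (by simpa using h), map_zero]

theorem exists_linChange {a₁ a₂ b₁ b₂ : K} (h : a₁ * b₂ - a₂ * b₁ ≠ 0) :
    ∃ φ : Pxy K ≃ₐ[K] Pxy K, IsLinChange φ ∧ IsLinChange φ.symm ∧
      φ (X 0) = C a₁ * X 0 + C a₂ * X 1 ∧ φ (X 1) = C b₁ * X 0 + C b₂ * X 1 := by
  have hlin : ∀ c d : K, (C c * X 0 + C d * X 1 : Pxy K).IsHomogeneous 1 := fun c d =>
    (isHomogeneous_C_mul_X c 0).add (isHomogeneous_C_mul_X d 1)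
  obtain ⟨r, hr⟩ : ∃ r, (a₁ * b₂ - a₂ * b₁) * r = 1 := ⟨_, mul_inv_cancel₀ h⟩
  have hC := congrArg (C : K → Pxy K) hr
  simp only [map_mul, map_sub, map_one] at hC
  let f : Pxy K →ₐ[K] Pxy K := aeval ![C a₁ * X 0 + C a₂ * X 1, C b₁ * X 0 + C b₂ * X 1]
  let g : Pxy K →ₐ[K] Pxy K :=
    aeval ![C (r * b₂) * X 0 + C (-(r * a₂)) * X 1, C (-(r * b₁)) * X 0 + C (r * a₁) * X 1]
  have hfg : f.comp g = AlgHom.id K _ := by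
    ext1 i
    fin_cases i <;> simp [f, g, algHom_C, algebraMap_eq]
    · linear_combination X 0 * hC
    · linear_combination X 1 * hC
  have hgf : g.comp f = AlgHom.id K _ := by
    ext1 i
    fin_cases i <;> simp [f, g, algHom_C, algebraMap_eq]
    · linear_combination X 0 * hC
    · linear_combination X 1 * hC
  refine ⟨AlgEquiv.ofAlgHom f g hfg hgf, fun i => ?_, fun i => ?_, by simp [f], by simp [f]⟩
  · fin_cases i <;> simpa [f] using hlin _ _
  · change (g (X i)).IsHomogeneous 1
    rw [aeval_X]
    fin_cases i <;> exact hlin _ _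

theorem apply_mul_mul_eq_polar (L : Pxy K →ₗ[K] K) (a₁ a₂ b₁ b₂ c₁ c₂ : K) :
    L ((C a₁ * X 0 + C a₂ * X 1) * (C b₁ * X 0 + C b₂ * X 1) * (C c₁ * X 0 + C c₂ * X 1)) =
      polar (L (X 0 ^ 3)) (L (X 0 ^ 2 * X 1)) (L (X 0 * X 1 ^ 2)) (L (X 1 ^ 3))
        a₁ a₂ b₁ b₂ c₁ c₂ := by
  have : ((C a₁ * X 0 + C a₂ * X 1) * (C b₁ * X 0 + C b₂ * X 1) *
      (C c₁ * X 0 + C c₂ * X 1) : Pxy K) =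
      (a₁ * b₁ * c₁) • X 0 ^ 3 + (a₁ * b₁ * c₂ + a₁ * b₂ * c₁ + a₂ * b₁ * c₁) • (X 0 ^ 2 * X 1) +
      (a₁ * b₂ * c₂ + a₂ * b₁ * c₂ + a₂ * b₂ * c₁) • (X 0 * X 1 ^ 2) +
      (a₂ * b₂ * c₂) • X 1 ^ 3 := by
    simp only [smul_eq_C_mul, map_add, map_mul]
    ring
  rw [this]
  simp only [map_add, map_smul, smul_eq_mul, polar]

theorem eq_of_cubics {L M : Pxy K →ₗ[K] K} (h₀ : L (X 0 ^ 3) = M (X 0 ^ 3))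
    (h₁ : L (X 0 ^ 2 * X 1) = M (X 0 ^ 2 * X 1)) (h₂ : L (X 0 * X 1 ^ 2) = M (X 0 * X 1 ^ 2))
    (h₃ : L (X 1 ^ 3) = M (X 1 ^ 3)) {p : Pxy K} (hp : p.IsHomogeneous 3) : L p = M p := by
  have hp' : p ∈ homogeneousSubmodule (Fin 2) K 3 := hp
  rw [homogeneousSubmodule_eq_span] at hp'
  refine LinearMap.eqOn_span (f := L) (g := M) ?_ hp'
  rintro _ ⟨i, rfl⟩
  fin_cases i <;> simpa

/-- The linear functional `f ↦ a f₃₀ + b f₂₁ + d f₀₃` in the coefficients of the cubic part. -/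
def cubicFunctional (a b d : K) : Pxy K →ₗ[K] K :=
  a • lcoeff K (Finsupp.single 0 3) + b • lcoeff K (Finsupp.single 0 2 + Finsupp.single 1 1) +
    d • lcoeff K (Finsupp.single 1 3)

theorem cubicFunctional_apply (a b d : K) :
    cubicFunctional a b d (X 0 ^ 3) = a ∧ cubicFunctional a b d (X 0 ^ 2 * X 1) = b ∧
      cubicFunctional a b d (X 0 * X 1 ^ 2) = 0 ∧ cubicFunctional a b d (X 1 ^ 3) = d := by
  have h : ∀ i j : ℕ, (X 0 ^ i * X 1 ^ j : Pxy K) =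
      monomial (Finsupp.single 0 i + Finsupp.single 1 j) 1 := fun i j => by
    rw [X_pow_eq_monomial, X_pow_eq_monomial, monomial_mul, one_mul]
  have h0 := h 3 0
  have h1 := h 2 1
  have h2 := h 1 2
  have h3 := h 0 3
  simp only [pow_zero, pow_one, one_mul, mul_one] at h0 h1 h2 h3
  rw [h0, h1, h2, h3]
  simp [cubicFunctional, coeff_monomial, Finsupp.ext_iff, Fin.forall_fin_two]

theorem map_eq_cubicIdeal {I : Ideal (Pxy K)} {L : Pxy K →ₗ[K] K}
    (hI : ∀ f, f ∈ I ↔ (∀ k < 3, homogeneousComponent k f = 0) ∧ L (homogeneousComponent 3 f) = 0)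
    {φ : Pxy K ≃ₐ[K] Pxy K} (hφ : IsLinChange φ) {a₁ a₂ b₁ b₂ a b d t : K} (ht : t ≠ 0)
    (h0 : φ (X 0) = C a₁ * X 0 + C a₂ * X 1) (h1 : φ (X 1) = C b₁ * X 0 + C b₂ * X 1)
    {P : K → K → K → K → K → K → K}
    (hP : P = polar (L (X 0 ^ 3)) (L (X 0 ^ 2 * X 1)) (L (X 0 * X 1 ^ 2)) (L (X 1 ^ 3)))
    (h₀ : P a₁ a₂ a₁ a₂ a₁ a₂ = t * a) (h₁ : P a₁ a₂ a₁ a₂ b₁ b₂ = t * b)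
    (h₂ : P a₁ a₂ b₁ b₂ b₁ b₂ = 0) (h₃ : P b₁ b₂ b₁ b₂ b₁ b₂ = t * d) :
    Ideal.map φ.symm I = cubicIdeal (cubicFunctional a b d) := by
  subst hP
  obtain ⟨e₀, e₁, e₂, e₃⟩ := cubicFunctional_apply a b d
  have key : ∀ p : Pxy K, p.IsHomogeneous 3 → L (φ p) = t * cubicFunctional a b d p :=
    fun p hp => by
      refine eq_of_cubics (L := L ∘ₗ φ.toLinearMap) (M := t • cubicFunctional a b d)
        ?_ ?_ ?_ ?_ hp <;>
      simp only [LinearMap.comp_apply, AlgEquiv.toLinearMap_apply, map_mul, map_pow, h0, h1,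
        LinearMap.smul_apply, e₀, e₁, e₂, e₃, smul_eq_mul, mul_zero]
      · rw [← h₀, ← apply_mul_mul_eq_polar]; ring_nf
      · rw [← h₁, ← apply_mul_mul_eq_polar]; ring_nf
      · rw [← h₂, ← apply_mul_mul_eq_polar]; ring_nf
      · rw [← h₃, ← apply_mul_mul_eq_polar]; ring_nf
  ext f
  have hmap : f ∈ Ideal.map φ.symm I ↔ φ f ∈ I :=
    (Ideal.mem_map_of_equiv φ.symm f).trans
      ⟨by rintro ⟨g, hg, rfl⟩; simpa using hg, fun h => ⟨_, h, by simp⟩⟩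
  rw [hmap, hI, mem_cubicIdeal]
  simp only [hφ.homogeneousComponent_apply, EmbeddingLike.map_eq_zero_iff,
    key _ (homogeneousComponent_isHomogeneous 3 f), mul_eq_zero, ht, false_or]

end Ideals

/-- There are three homogeneous ideals covering, up to linear change of variables,
all homogeneous ideals of type `(1, 2, 3, 1)`. -/
theorem stmt6 (K : Type*) [Field K] [IsAlgClosed K] [CharZero K] :
    ∃ J₁ J₂ J₃ : Ideal (Pxy K), IsHomog J₁ ∧ IsHomog J₂ ∧ IsHomog J₃ ∧
      ∀ I : Ideal (Pxy K), IsHomog I →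
        hilb K I 0 = 1 → hilb K I 1 = 2 → hilb K I 2 = 3 → hilb K I 3 = 1 →
        (∀ k, 4 ≤ k → hilb K I k = 0) →
        ∃ φ : Pxy K ≃ₐ[K] Pxy K, IsLinChange φ ∧
          (Ideal.map φ I = J₁ ∨ Ideal.map φ I = J₂ ∨ Ideal.map φ I = J₃) := by
  refine ⟨cubicIdeal (cubicFunctional 1 0 1), cubicIdeal (cubicFunctional 0 1 0),
    cubicIdeal (cubicFunctional 1 0 0), isHomog_cubicIdeal _, isHomog_cubicIdeal _,
    isHomog_cubicIdeal _, fun I hI h0 h1 h2 h3 h4 => ?_⟩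
  obtain ⟨L, ⟨p, hp, hLp⟩, hL⟩ := exists_functional hI h0 h1 h2 h3 h4
  have hne : ¬(L (X 0 ^ 3) = 0 ∧ L (X 0 ^ 2 * X 1) = 0 ∧ L (X 0 * X 1 ^ 2) = 0 ∧
      L (X 1 ^ 3) = 0) := fun ⟨hA, hB, hC, hD⟩ =>
    hLp (eq_of_cubics (M := 0) hA hB hC hD hp)
  obtain ⟨a₁, a₂, b₁, b₂, t, hdet, ht, h⟩ := hasNormalForm hne
  obtain ⟨φ, hφ, hφ', hX, hY⟩ := exists_linChange hdet
  refine ⟨φ.symm, hφ', ?_⟩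
  rcases h with ⟨e₀, e₁, e₂, e₃⟩ | ⟨e₀, e₁, e₂, e₃⟩ | ⟨e₀, e₁, e₂, e₃⟩
  · exact .inl (map_eq_cubicIdeal hL hφ ht hX hY rfl (by simpa) (by simpa) e₂ (by simpa))
  · exact .inr (.inl (map_eq_cubicIdeal hL hφ ht hX hY rfl (by simpa) (by simpa) e₂ (by simpa)))
  · exact .inr (.inr (map_eq_cubicIdeal hL hφ ht hX hY rfl (by simpa) (by simpa) e₂ (by simpa)))
end
end

section
/- Let K be an algebraically closed field, let I be a homogeneous ideal of K[x,y], and let n, s, k be natural numbers with s ≤ n and k ≥ 1. Suppose dim_K (K[x,y]_j / (I ∩ K[x,y]_j)) = s for every j with n ≤ j ≤ n+k. Then there exists a homogeneous polynomial h of degree s such that I ∩ K[x,y]_j = h·K[x,y]_{j−s} for every j with n ≤ j ≤ n+k. -/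
open MvPolynomial

noncomputable section

lemma MvPolynomial.IsHomogeneous.of_X_mul {σ R : Type*} [CommSemiring R] {i : σ} {n : ℕ}
    {f : MvPolynomial σ R} (hf : (X i * f).IsHomogeneous (n + 1)) : f.IsHomogeneous n := by
  intro d hd
  have h := hf (d := Finsupp.single i 1 + d) (by rwa [coeff_X_mul])
  rw [map_add, Finsupp.weight_single] at h
  simp only [Pi.one_apply, smul_eq_mul, mul_one] at h
  omega

lemma MvPolynomial.homogeneousSubmodule_succ_le_sup {R : Type*} [CommRing R] (n : ℕ) :
    homogeneousSubmodule (Fin 2) R (n + 1) ≤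
      (homogeneousSubmodule (Fin 2) R n).map (LinearMap.mulLeft R (X 0)) ⊔
        (homogeneousSubmodule (Fin 2) R n).map (LinearMap.mulLeft R (X 1)) := by
  rw [← homogeneousSubmodule_one_pow, pow_succ', homogeneousSubmodule_one_pow, Submodule.mul_le]
  intro a ha b hb
  rw [homogeneousSubmodule_one_eq_span_X] at ha
  induction ha using Submodule.span_induction with
  | mem a ha =>
    obtain ⟨i, rfl⟩ := ha
    fin_cases i
    · exact Submodule.mem_sup_left ⟨b, hb, rfl⟩
    · exact Submodule.mem_sup_right ⟨b, hb, rfl⟩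
  | zero => simp
  | add a c _ _ iha ihc => rw [add_mul]; exact add_mem iha ihc
  | smul r a _ iha => rw [smul_mul_assoc]; exact Submodule.smul_mem _ r iha

section

variable {K : Type*} [Field K]

instance MvPolynomial.finiteDimensional_homogeneousSubmodule {σ : Type*} [Finite σ] (n : ℕ) :
    FiniteDimensional K (homogeneousSubmodule σ K n) :=
  Module.Finite.iff_fg.mpr (homogeneousSubmodule_fg σ K n)

lemma MvPolynomial.finrank_homogeneousSubmodule_fin_two (n : ℕ) :
    Module.finrank K (homogeneousSubmodule (Fin 2) K n) = n + 1 := by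
  have hset : {d : Fin 2 →₀ ℕ | d.degree = n} =
      ((Finset.univ : Finset (Fin 2)).finsuppAntidiag n : Set (Fin 2 →₀ ℕ)) := by
    ext d
    simp [Finsupp.degree_eq_sum]
  rw [homogeneousSubmodule_eq_finsupp_supported, hset,
    (AddMonoidAlgebra.supportedEquivFinsupp _).finrank_eq, Module.finrank_finsupp_self]
  simp [Finset.card_finsuppAntidiag_nat_eq_choose, Nat.add_comm 1 n]

lemma LinearMap.finrank_map_mulLeft {A : Type*} [CommRing A] [IsDomain A] [Algebra K A] {a : A}
    (ha : a ≠ 0) (V : Submodule K A) :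
    Module.finrank K (V.map (LinearMap.mulLeft K a)) = Module.finrank K V :=
  (Submodule.equivMapOfInjective (LinearMap.mulLeft K a) (mul_right_injective₀ ha) V).finrank_eq.symm

lemma MvPolynomial.map_mulLeft_X_inf_le (V : Submodule K (MvPolynomial (Fin 2) K)) :
    V.map (LinearMap.mulLeft K (X 0)) ⊓ V.map (LinearMap.mulLeft K (X 1)) ≤
      (V.comap (LinearMap.mulLeft K (X 0)) ⊓ V.comap (LinearMap.mulLeft K (X 1))).map
        (LinearMap.mulLeft K (X 0 * X 1)) := by
  rintro _ ⟨⟨a, ha, rfl⟩, ⟨b, hb, hab⟩⟩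
  simp only [LinearMap.mulLeft_apply] at hab
  have hdvd : (X 0 : MvPolynomial (Fin 2) K) ∣ X 1 * b := ⟨a, hab⟩
  obtain h | ⟨f, rfl⟩ := X_prime.dvd_or_dvd hdvd
  · rw [X_dvd_X] at h
    exact absurd h (by decide)
  have haf : a = X 1 * f := mul_left_cancel₀ (X_ne_zero (0 : Fin 2)) (by rw [← hab]; ring)
  refine ⟨f, ⟨hb, ?_⟩, ?_⟩
  · simpa [haf] using ha
  · simp [haf]

/-- A nonzero space of binary forms of degree `n` whose product with the linear forms has dimension
at most one more consists of all the multiples of a single form. -/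
theorem MvPolynomial.exists_eq_map_mulLeft_of_finrank_le_succ (n : ℕ)
    (V W : Submodule K (MvPolynomial (Fin 2) K)) (hV : V ≤ homogeneousSubmodule (Fin 2) K n)
    [FiniteDimensional K W] (hV0 : V ≠ ⊥)
    (hx : V.map (LinearMap.mulLeft K (X 0)) ≤ W) (hy : V.map (LinearMap.mulLeft K (X 1)) ≤ W)
    (hW : Module.finrank K W ≤ Module.finrank K V + 1) :
    ∃ s ≤ n, ∃ h : MvPolynomial (Fin 2) K, h ≠ 0 ∧ h.IsHomogeneous s ∧
      V = (homogeneousSubmodule (Fin 2) K (n - s)).map (LinearMap.mulLeft K h) := by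
  induction n generalizing V W with
  | zero =>
    refine ⟨0, le_rfl, 1, one_ne_zero, isHomogeneous_one _ _, ?_⟩
    have : FiniteDimensional K V := Submodule.finiteDimensional_of_le hV
    have hpos := Submodule.one_le_finrank_iff.mpr hV0
    rw [LinearMap.mulLeft_one, Submodule.map_id]
    exact Submodule.eq_of_le_of_finrank_le hV (by rwa [finrank_homogeneousSubmodule_fin_two])
  | succ n ih =>
    have : FiniteDimensional K V := Submodule.finiteDimensional_of_le hV
    have hpos := Submodule.one_le_finrank_iff.mpr hV0
    obtain hone | htwo := hpos.eq_or_lt'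
    · obtain ⟨h, hh0, hh⟩ := finrank_eq_one_iff'.mp hone
      refine ⟨n + 1, le_rfl, h, by simpa using hh0, hV h.2, le_antisymm ?_ ?_⟩
      · intro v hv
        obtain ⟨c, hc⟩ := hh ⟨v, hv⟩
        refine ⟨C c, by simp, ?_⟩
        rw [LinearMap.mulLeft_apply, mul_comm, ← smul_eq_C_mul]
        exact congrArg Subtype.val hc
      · rw [Nat.sub_self, homogeneousSubmodule_zero]
        rintro _ ⟨q, hq, rfl⟩
        obtain ⟨c, rfl⟩ := Submodule.mem_one.mp hq
        rw [LinearMap.mulLeft_apply, mul_comm, algebraMap_eq, ← smul_eq_C_mul]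
        exact V.smul_mem c h.2
    · set U := V.comap (LinearMap.mulLeft K (X 0)) ⊓ V.comap (LinearMap.mulLeft K (X 1)) with hU
      have hUn : U ≤ homogeneousSubmodule (Fin 2) K n := fun f hf ↦ (hV hf.1).of_X_mul
      have : FiniteDimensional K U := Submodule.finiteDimensional_of_le hUn
      have hUV : Module.finrank K V ≤ Module.finrank K U + 1 := by
        have hsum := Submodule.finrank_sup_add_finrank_inf_eq
          (V.map (LinearMap.mulLeft K (X 0))) (V.map (LinearMap.mulLeft K (X 1)))
        have hinf := Submodule.finrank_mono (map_mulLeft_X_inf_le V)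
        have hsup := Submodule.finrank_mono (sup_le hx hy)
        rw [LinearMap.finrank_map_mulLeft (mul_ne_zero (X_ne_zero _) (X_ne_zero _)), ← hU] at hinf
        rw [LinearMap.finrank_map_mulLeft (X_ne_zero _),
          LinearMap.finrank_map_mulLeft (X_ne_zero _)] at hsum
        omega
      have hU0 : U ≠ ⊥ := Submodule.one_le_finrank_iff.mp (by omega)
      obtain ⟨s, hs, h, hh0, hh, hUeq⟩ := ih U V hUn hU0
        (Submodule.map_le_iff_le_comap.mpr inf_le_left)
        (Submodule.map_le_iff_le_comap.mpr inf_le_right) hUV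
      refine ⟨s, by omega, h, hh0, hh, Eq.symm (Submodule.eq_of_le_of_finrank_le ?_ ?_)⟩
      · rw [Nat.succ_sub hs, Submodule.map_le_iff_le_comap]
        refine (homogeneousSubmodule_succ_le_sup _).trans (sup_le ?_ ?_)
        all_goals
          rintro _ ⟨q, hq, rfl⟩
          have hqU : h * q ∈ U := hUeq ▸ ⟨q, hq, rfl⟩
        · simpa [mul_left_comm] using hqU.1
        · simpa [mul_left_comm] using hqU.2
      · rw [hUeq, LinearMap.finrank_map_mulLeft hh0, finrank_homogeneousSubmodule_fin_two] at hUV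
        rw [LinearMap.finrank_map_mulLeft hh0, finrank_homogeneousSubmodule_fin_two]
        omega

lemma hilb_add_finrank (I : Ideal (Pxy K)) (j : ℕ) :
    hilb K I j + Module.finrank K
      (I.restrictScalars K ⊓ homogeneousSubmodule (Fin 2) K j : Submodule K (MvPolynomial (Fin 2) K)) = j + 1 := by
  rw [hilb, ← finrank_homogeneousSubmodule_fin_two (K := K) j, inf_comm,
    ← Submodule.map_comap_subtype, Submodule.finrank_map_subtype_eq]
  exact Submodule.finrank_quotient_add_finrank _

end

/-- If the Hilbert function of `I` equals `s` in all degrees `n ≤ j ≤ n+k` with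
`k ≥ 1`, then there is a homogeneous `h` of degree `s` with
`I ∩ K[x,y]_j = h·K[x,y]_{j-s}` for all such `j`. -/
theorem stmt9 (K : Type*) [Field K] [IsAlgClosed K]
    (I : Ideal (Pxy K)) (hI : IsHomog I) (n s k : ℕ) (hs : s ≤ n) (hk : 1 ≤ k)
    (hdim : ∀ j, n ≤ j → j ≤ n + k → hilb K I j = s) :
    ∃ h : Pxy K, h.IsHomogeneous s ∧
      ∀ j, n ≤ j → j ≤ n + k →
        I.restrictScalars K ⊓ homogeneousSubmodule (Fin 2) K j =
          Submodule.map (LinearMap.mulLeft K h)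
            (homogeneousSubmodule (Fin 2) K (j - s)) := by
  have hfin (j) (h₁ : n ≤ j) (h₂ : j ≤ n + k) :
      s + Module.finrank K ↥(I.restrictScalars K ⊓ homogeneousSubmodule (Fin 2) K j) = j + 1 :=
    hdim j h₁ h₂ ▸ hilb_add_finrank I j
  have hn := hfin n le_rfl (by omega)
  have hpos : 1 ≤ Module.finrank K ↥(I.restrictScalars K ⊓ homogeneousSubmodule (Fin 2) K n) := by
    omega
  have hsucc : Module.finrank K ↥(I.restrictScalars K ⊓ homogeneousSubmodule (Fin 2) K (n + 1)) ≤
      Module.finrank K ↥(I.restrictScalars K ⊓ homogeneousSubmodule (Fin 2) K n) + 1 := by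
    have := hfin (n + 1) (by omega) (by omega)
    omega
  have hmul (i : Fin 2) :
      (I.restrictScalars K ⊓ homogeneousSubmodule (Fin 2) K n).map (LinearMap.mulLeft K (X i)) ≤
        I.restrictScalars K ⊓ homogeneousSubmodule (Fin 2) K (n + 1) := by
    rintro _ ⟨f, ⟨hfI, hf⟩, rfl⟩
    refine ⟨I.mul_mem_left _ hfI, ?_⟩
    rw [add_comm]
    exact (isHomogeneous_X K i).mul hf
  obtain ⟨s', hs', h, hh0, hh, heq⟩ := exists_eq_map_mulLeft_of_finrank_le_succ n
    (I.restrictScalars K ⊓ homogeneousSubmodule (Fin 2) K n)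
    (I.restrictScalars K ⊓ homogeneousSubmodule (Fin 2) K (n + 1))
    inf_le_right (Submodule.one_le_finrank_iff.mp hpos) (hmul 0) (hmul 1) hsucc
  rw [heq, LinearMap.finrank_map_mulLeft hh0, finrank_homogeneousSubmodule_fin_two] at hn
  obtain rfl : s' = s := by omega
  refine ⟨h, hh, fun j h₁ h₂ ↦ Eq.symm (Submodule.eq_of_le_of_finrank_le ?_ ?_)⟩
  · refine le_inf ?_ ?_
    · induction j, h₁ using Nat.le_induction with
      | base => exact heq ▸ inf_le_left
      | succ j hj ih =>
        rw [Nat.succ_sub (hs.trans hj), Submodule.map_le_iff_le_comap]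
        refine (homogeneousSubmodule_succ_le_sup _).trans (sup_le ?_ ?_)
        all_goals
          rintro _ ⟨q, hq, rfl⟩
          have hqI : h * q ∈ I := ih (by omega) ⟨q, hq, rfl⟩
          simpa [mul_left_comm] using I.mul_mem_left _ hqI
    · rintro _ ⟨q, hq, rfl⟩
      rw [← Nat.add_sub_cancel' (hs.trans h₁)]
      exact hh.mul hq
  · have := hfin j h₁ h₂
    rw [LinearMap.finrank_map_mulLeft hh0, finrank_homogeneousSubmodule_fin_two]
    omega
end
end
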